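/- Suppose p ∈ ℤ^n and q ∈ ℤ^m have positive nonincreasing entries with Σ_j p_j = Σ_i q_i = N. Then the Gurvits capacity of the reduced operator equals the capacity with specified marginals: inf over positive-definite X ∈ Mat_N(ℂ) of det((trun_{P,Q} T)(X)) / det(X) equals cap(T, P, Q). -/

import Mathlib

open Matrix BigOperators ComplexOrder

noncomputable section

/-- `η_j` : the projection onto the first `j` coordinates, as a `j × k` matrix. -/
def proj (j k : ℕ) : Matrix (Fin j) (Fin k) ℂ :=
  Matrix.of fun i l => if (i : ℕ) = (l : ℕ) then 1 else 0

/-- `Δa_j = a_j − a_{j+1}`, with the convention `a_{k+1} = 0`. -/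
def delta {k : ℕ} (a : Fin k → ℝ) (j : Fin k) : ℝ :=
  a j - (if h : (j : ℕ) + 1 < k then a ⟨(j : ℕ) + 1, h⟩ else 0)

/-- Integer version of `delta`. -/
def deltaNat {k : ℕ} (a : Fin k → ℕ) (j : Fin k) : ℕ :=
  a j - (if h : (j : ℕ) + 1 < k then a ⟨(j : ℕ) + 1, h⟩ else 0)

/-- The relative determinant `det(diag a, X) = ∏_j det(η_j X η_j†)^{Δa_j}` (real exponents,
with the convention `0 ^ 0 = 1`). -/
def relDet {k : ℕ} (a : Fin k → ℝ) (X : Matrix (Fin k) (Fin k) ℂ) : ℝ :=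
  ∏ j : Fin k,
    ((proj ((j : ℕ) + 1) k * X * (proj ((j : ℕ) + 1) k)ᴴ).det.re) ^ (delta a j)

/-- Complex relative determinant for integral weights. -/
def relDetC {k : ℕ} (a : Fin k → ℕ) (X : Matrix (Fin k) (Fin k) ℂ) : ℂ :=
  ∏ j : Fin k,
    ((proj ((j : ℕ) + 1) k * X * (proj ((j : ℕ) + 1) k)ᴴ).det) ^ (deltaNat a j)

/-- The completely positive map `T(X) = Σ A_i X A_i†` with Kraus operators `A i`. -/
def cpMap {ι κ : Type*} [Fintype ι] {r : ℕ} (A : Fin r → Matrix κ ι ℂ)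
    (X : Matrix ι ι ℂ) : Matrix κ κ ℂ :=
  ∑ i, A i * X * (A i)ᴴ

/-- The dual completely positive map `T*(Y) = Σ A_i† Y A_i`. -/
def cpDual {ι κ : Type*} [Fintype κ] {r : ℕ} (A : Fin r → Matrix κ ι ℂ)
    (Y : Matrix κ κ ℂ) : Matrix ι ι ℂ :=
  ∑ i, (A i)ᴴ * Y * A i

/-- Frobenius norm `‖A‖ = √(Tr A Aᴴ)`. -/
def frob {ι κ : Type*} [Fintype ι] [Fintype κ] (A : Matrix ι κ ℂ) : ℝ :=
  Real.sqrt (A * Aᴴ).trace.re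

/-- Upper triangular predicate. -/
def UT {k : ℕ} (g : Matrix (Fin k) (Fin k) ℂ) : Prop :=
  ∀ i j : Fin k, j < i → g i j = 0

/-- Capacity with specified marginals:
`cap(T,P,Q) = inf over invertible upper triangular h of det(Q, T(hPh†)) / det(P, h†h)`. -/
def cap {n m r : ℕ} (A : Fin r → Matrix (Fin m) (Fin n) ℂ)
    (p : Fin n → ℝ) (q : Fin m → ℝ) : ℝ :=
  sInf { x : ℝ | ∃ h : Matrix (Fin n) (Fin n) ℂ, IsUnit h.det ∧ UT h ∧
    x = relDet q (cpMap A (h * Matrix.diagonal (fun j => (p j : ℂ)) * hᴴ)) /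
        relDet p (hᴴ * h) }

/-- Span of the first `i` standard basis vectors of `ℂ^k`. -/
def coordSub (k i : ℕ) : Submodule ℂ (Fin k → ℂ) where
  carrier := { x | ∀ l : Fin k, i ≤ (l : ℕ) → x l = 0 }
  add_mem' := by intro a b ha hb l hl; simp [ha l hl, hb l hl]
  zero_mem' := by intro l _; rfl
  smul_mem' := by intro c x hx l hl; simp [hx l hl]

/-- `(L, R)` is a `T`-independent pair: `A_i R ⊥ L` for all `i`. -/
def TIndep {n m r : ℕ} (A : Fin r → Matrix (Fin m) (Fin n) ℂ)
    (L : Submodule ℂ (Fin m → ℂ)) (R : Submodule ℂ (Fin n → ℂ)) : Prop :=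
  ∀ i : Fin r, ∀ x ∈ R, ∀ y ∈ L, star y ⬝ᵥ (A i).mulVec x = 0

/-- `(P,Q)`-rank-nondecreasingness. -/
def rankNonDec {n m r : ℕ} (A : Fin r → Matrix (Fin m) (Fin n) ℂ)
    (p : Fin n → ℝ) (q : Fin m → ℝ) : Prop :=
  ∀ L : Submodule ℂ (Fin m → ℂ), ∀ R : Submodule ℂ (Fin n → ℂ), TIndep A L R →
    (∑ i : Fin m, delta q i * (Module.finrank ℂ ↥(coordSub m ((i : ℕ) + 1) ⊓ L) : ℝ)) +
      (∑ j : Fin n, delta p j * (Module.finrank ℂ ↥(coordSub n ((j : ℕ) + 1) ⊓ R) : ℝ))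
      ≤ ∑ j, p j

/-- `λ'_{i+1}`: number of parts of `lam` that are `> i` (0-indexed conjugate partition). -/
def conj' {k : ℕ} (lam : Fin k → ℕ) (i : ℕ) : ℕ :=
  (Finset.univ.filter fun j : Fin k => i < lam j).card

lemma conj'_le {k : ℕ} (lam : Fin k → ℕ) (i : ℕ) : conj' lam i ≤ k := by
  classical
  calc conj' lam i ≤ Finset.univ.card := Finset.card_filter_le _ _
    _ = k := by simp

/-- Index set for the blocks of `G_λ`; it has cardinality `Σ_i λ'_i = Σ_j λ_j`. -/
abbrev lamIdx {k : ℕ} (lam : Fin k → ℕ) : Type :=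
  Σ i : Fin (Finset.univ.sup lam), Fin (conj' lam (i : ℕ))

/-- The gadget map `G_λ(X) = ⊕_{i=1}^{λ_1} η_{λ'_i} X η_{λ'_i}†`. -/
def Gmap {k : ℕ} (lam : Fin k → ℕ) (X : Matrix (Fin k) (Fin k) ℂ) :
    Matrix (lamIdx lam) (lamIdx lam) ℂ := fun s t =>
  if s.1 = t.1 then
    X (Fin.castLE (conj'_le lam (s.1 : ℕ)) s.2) (Fin.castLE (conj'_le lam (t.1 : ℕ)) t.2)
  else 0

/-- The adjoint `G_λ*` of the gadget map with respect to the trace inner product. -/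
def GmapAdj {k : ℕ} (lam : Fin k → ℕ) (Y : Matrix (lamIdx lam) (lamIdx lam) ℂ) :
    Matrix (Fin k) (Fin k) ℂ := fun a b =>
  ∑ i : Fin (Finset.univ.sup lam),
    if h : (a : ℕ) < conj' lam (i : ℕ) ∧ (b : ℕ) < conj' lam (i : ℕ) then
      Y ⟨i, ⟨(a : ℕ), h.1⟩⟩ ⟨i, ⟨(b : ℕ), h.2⟩⟩
    else 0

/-- The reduction `trun_{P,Q} T = G_q ∘ T ∘ G_p*`. -/
def trun {n m r : ℕ} (A : Fin r → Matrix (Fin m) (Fin n) ℂ) (p : Fin n → ℕ) (q : Fin m → ℕ)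
    (X : Matrix (lamIdx p) (lamIdx p) ℂ) : Matrix (lamIdx q) (lamIdx q) ℂ :=
  Gmap q (cpMap A (GmapAdj p X))

/-- The dual of the reduction: `(trun_{P,Q} T)* = G_p ∘ T* ∘ G_q*`. -/
def trunDual {n m r : ℕ} (A : Fin r → Matrix (Fin m) (Fin n) ℂ) (p : Fin n → ℕ) (q : Fin m → ℕ)
    (Y : Matrix (lamIdx q) (lamIdx q) ℂ) : Matrix (lamIdx p) (lamIdx p) ℂ :=
  Gmap p (cpDual A (GmapAdj q Y))

/-- Shannon entropy with convention `0 · log 0 = 0` (note `Real.log 0 = 0`). -/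
def entropy {k : ℕ} (p : Fin k → ℝ) : ℝ := -∑ j, p j * Real.log (p j)

/-- The distance-to-target measure `ds_{P,Q}(T)`. -/
def ds {n m r : ℕ} (A : Fin r → Matrix (Fin m) (Fin n) ℂ)
    (p : Fin n → ℝ) (q : Fin m → ℝ) : ℝ :=
  (∑ j : Fin n, delta p j *
      (frob (proj ((j : ℕ) + 1) n *
        (cpDual A (Matrix.diagonal fun i => (q i : ℂ)) - 1) * (proj ((j : ℕ) + 1) n)ᴴ)) ^ 2) +
    ∑ i : Fin m, delta q i *
      (frob (proj ((i : ℕ) + 1) m *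
        (cpMap A (Matrix.diagonal fun j => (p j : ℂ)) - 1) * (proj ((i : ℕ) + 1) m)ᴴ)) ^ 2

/-- `(u_1,…,u_n)` can be approximately put in `Q`-isotropic position with respect to `p`. -/
def approxIso {m n : ℕ} (u : Fin n → Fin m → ℂ) (p : Fin n → ℝ)
    (Q : Matrix (Fin m) (Fin m) ℂ) : Prop :=
  ∀ ε : ℝ, 0 < ε → ∃ B : Matrix (Fin m) (Fin m) ℂ, IsUnit B.det ∧
    frob ((∑ i : Fin n,
      (((p i / ∑ a, Complex.normSq (B.mulVec (u i) a)) : ℝ) : ℂ) •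
        Matrix.vecMulVec (B.mulVec (u i)) (star (B.mulVec (u i)))) - Q) ≤ ε

section Conjugate

variable {k : ℕ} {lam : Fin k → ℕ}

lemma lt_conj'_iff (hl : Antitone lam) (j : Fin k) (i : ℕ) :
    (j : ℕ) < conj' lam i ↔ i < lam j := by
  unfold conj'
  constructor
  · intro h
    by_contra hc
    have hsub : (Finset.univ.filter fun a : Fin k => i < lam a) ⊆ Finset.Iio j := by
      intro a ha
      simp only [Finset.mem_filter, Finset.mem_univ, true_and] at ha
      rw [Finset.mem_Iio]
      by_contra hja
      exact hc (ha.trans_le (hl (not_lt.1 hja)))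
    have := Finset.card_le_card hsub
    rw [Fin.card_Iio] at this
    omega
  · intro h
    have hsub : Finset.Iic j ⊆ (Finset.univ.filter fun a : Fin k => i < lam a) := by
      intro a ha
      simp only [Finset.mem_filter, Finset.mem_univ, true_and]
      exact h.trans_le (hl (Finset.mem_Iic.1 ha))
    have := Finset.card_le_card hsub
    rw [Fin.card_Iic] at this
    omega

lemma conj'_pos (i : Fin (Finset.univ.sup lam)) : 0 < conj' lam (i : ℕ) := by
  obtain ⟨j, -, hj⟩ := Finset.lt_sup_iff.1 i.2
  exact Finset.card_pos.2 ⟨j, by simpa using hj⟩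

lemma card_filter_fin_lt {a M : ℕ} (ha : a ≤ M) :
    (Finset.univ.filter fun i : Fin M => (i : ℕ) < a).card = a := by
  simp [Fin.card_filter_val_lt, ha]

lemma le_sup_univ (j : Fin k) : lam j ≤ Finset.univ.sup lam :=
  Finset.le_sup (f := lam) (Finset.mem_univ j)

/-- The part `j + 1` occurs `λ_j − λ_{j+1}` times in the conjugate partition. -/
lemma card_conj'_eq (hl : Antitone lam) (j : Fin k) :
    (Finset.univ.filter fun i : Fin (Finset.univ.sup lam) =>
      conj' lam (i : ℕ) = (j : ℕ) + 1).card = deltaNat lam j := by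
  set b : ℕ := if h : (j : ℕ) + 1 < k then lam ⟨(j : ℕ) + 1, h⟩ else 0 with hb
  have hbj : b ≤ lam j := by
    rw [hb]
    split_ifs with h
    · exact hl (Fin.mk_le_mk.2 (Nat.le_succ _))
    · exact Nat.zero_le _
  have hiff (i : ℕ) : conj' lam i = (j : ℕ) + 1 ↔ i < lam j ∧ ¬ i < b := by
    rw [← lt_conj'_iff hl j i]
    have hb' : i < b ↔ (j : ℕ) + 1 < conj' lam i := by
      rw [hb]
      split_ifs with h
      · exact (lt_conj'_iff hl ⟨(j : ℕ) + 1, h⟩ i).symm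
      · have := conj'_le lam i
        omega
    rw [hb']
    omega
  have hset : (Finset.univ.filter fun i : Fin (Finset.univ.sup lam) =>
      conj' lam (i : ℕ) = (j : ℕ) + 1) =
      (Finset.univ.filter fun i : Fin (Finset.univ.sup lam) => (i : ℕ) < lam j) \
        (Finset.univ.filter fun i : Fin (Finset.univ.sup lam) => (i : ℕ) < b) := by
    ext i
    simp [hiff]
  rw [hset, Finset.card_sdiff_of_subset, card_filter_fin_lt (le_sup_univ j),
    card_filter_fin_lt (hbj.trans (le_sup_univ j))]
  · rfl
  · intro i hi
    simp only [Finset.mem_filter, Finset.mem_univ, true_and] at hi ⊢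
    omega

lemma prod_conj' (hl : Antitone lam) (f : ℕ → ℝ) :
    ∏ i : Fin (Finset.univ.sup lam), f (conj' lam (i : ℕ)) =
      ∏ j : Fin k, f ((j : ℕ) + 1) ^ deltaNat lam j := by
  have hg (i : Fin (Finset.univ.sup lam)) : conj' lam (i : ℕ) - 1 < k := by
    have := conj'_pos i
    have := conj'_le lam (i : ℕ)
    omega
  rw [← Finset.prod_fiberwise (s := Finset.univ)
    (g := fun i : Fin (Finset.univ.sup lam) => (⟨conj' lam (i : ℕ) - 1, hg i⟩ : Fin k))]
  refine Finset.prod_congr rfl fun j _ => ?_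
  rw [← card_conj'_eq hl j, ← Finset.prod_const]
  have hiff (i : Fin (Finset.univ.sup lam)) :
      (⟨conj' lam (i : ℕ) - 1, hg i⟩ : Fin k) = j ↔ conj' lam (i : ℕ) = (j : ℕ) + 1 := by
    have := conj'_pos i
    rw [Fin.ext_iff]
    simp only
    omega
  refine Finset.prod_congr (by ext i; simp [hiff]) fun i hi => ?_
  rw [(Finset.mem_filter.1 hi).2]

lemma delta_natCast (hl : Antitone lam) (j : Fin k) :
    delta (fun a => (lam a : ℝ)) j = (deltaNat lam j : ℝ) := by
  unfold delta deltaNat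
  split_ifs with h
  · rw [Nat.cast_sub (hl (Fin.mk_le_mk.2 (Nat.le_succ _)))]
  · simp

end Conjugate

section Gadget

variable {k : ℕ} {lam : Fin k → ℕ}

/-- The leading principal `c × c` block of a matrix. -/
def leadingBlock {c : ℕ} (hc : c ≤ k) (X : Matrix (Fin k) (Fin k) ℂ) :
    Matrix (Fin c) (Fin c) ℂ :=
  X.submatrix (Fin.castLE hc) (Fin.castLE hc)

lemma proj_mul_mul_conjTranspose {c : ℕ} (hc : c ≤ k) (X : Matrix (Fin k) (Fin k) ℂ) :
    proj c k * X * (proj c k)ᴴ = leadingBlock hc X := by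
  have h (i : Fin c) (l : Fin k) :
      proj c k i l = if l = Fin.castLE hc i then 1 else 0 := by
    simp [proj, Fin.ext_iff, eq_comm]
  ext i j
  simp [Matrix.mul_apply, Matrix.conjTranspose_apply, h, leadingBlock]

lemma Gmap_eq_blockDiagonal' (X : Matrix (Fin k) (Fin k) ℂ) :
    Gmap lam X = Matrix.blockDiagonal' fun i : Fin (Finset.univ.sup lam) =>
      leadingBlock (conj'_le lam (i : ℕ)) X := by
  ext ⟨i, a⟩ ⟨j, b⟩
  by_cases hij : i = j
  · subst hij
    simp [Gmap, leadingBlock]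
  · rw [Matrix.blockDiagonal'_apply_ne _ _ _ hij]
    simp [Gmap, hij]

lemma det_blockDiagonal'_fintype {ι : Type*} [Fintype ι] [LinearOrder ι] {β : ι → Type*}
    [∀ i, Fintype (β i)] [∀ i, DecidableEq (β i)] (M : ∀ i, Matrix (β i) (β i) ℂ) :
    (Matrix.blockDiagonal' M).det = ∏ i, (M i).det := by
  rw [(Matrix.blockTriangular_blockDiagonal' M).det_fintype]
  refine Finset.prod_congr rfl fun i _ => ?_
  rw [← Matrix.det_submatrix_equiv_self (Equiv.sigmaSubtype i).symm]
  congr 1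
  ext a b
  simp [Matrix.toSquareBlock_def, Equiv.sigmaSubtype]

lemma det_Gmap (X : Matrix (Fin k) (Fin k) ℂ) :
    (Gmap lam X).det = ∏ i : Fin (Finset.univ.sup lam),
      (leadingBlock (conj'_le lam (i : ℕ)) X).det := by
  rw [Gmap_eq_blockDiagonal', det_blockDiagonal'_fintype]

lemma det_Gmap_of_posSemidef (hl : Antitone lam) {Z : Matrix (Fin k) (Fin k) ℂ}
    (hZ : Z.PosSemidef) :
    (Gmap lam Z).det = (relDet (fun j => (lam j : ℝ)) Z : ℝ) := by
  have hrel : relDet (fun j => (lam j : ℝ)) Z = ∏ i : Fin (Finset.univ.sup lam),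
      (proj (conj' lam (i : ℕ)) k * Z * (proj (conj' lam (i : ℕ)) k)ᴴ).det.re := by
    rw [prod_conj' hl (fun c => (proj c k * Z * (proj c k)ᴴ).det.re)]
    unfold relDet
    refine Finset.prod_congr rfl fun j _ => ?_
    rw [delta_natCast hl, Real.rpow_natCast]
  rw [hrel, det_Gmap, Complex.ofReal_prod]
  refine Finset.prod_congr rfl fun i _ => ?_
  have h0 := (hZ.submatrix (Fin.castLE (conj'_le lam (i : ℕ)))).det_nonneg
  rw [proj_mul_mul_conjTranspose (conj'_le lam (i : ℕ))]
  exact Complex.eq_re_of_ofReal_le (r := 0) (by rw [Complex.ofReal_zero]; exact h0)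

lemma relDet_nonneg {a : Fin k → ℝ} {Z : Matrix (Fin k) (Fin k) ℂ} (hZ : Z.PosSemidef) :
    0 ≤ relDet a Z := by
  refine Finset.prod_nonneg fun j _ => Real.rpow_nonneg ?_ _
  exact (Complex.le_def.1 (hZ.mul_mul_conjTranspose_same (proj ((j : ℕ) + 1) k)).det_nonneg).1

/-- The inclusion of the `i`-th block of `G_λ` into `ℂ^k`. -/
def blockEmbed (lam : Fin k → ℕ) (i : Fin (Finset.univ.sup lam)) :
    Matrix (Fin k) (lamIdx lam) ℂ :=
  Matrix.of fun a s => if s.1 = i ∧ (s.2 : ℕ) = (a : ℕ) then 1 else 0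

lemma mul_blockEmbed_apply {ι : Type*} (M : Matrix ι (Fin k) ℂ)
    (i : Fin (Finset.univ.sup lam)) (a : ι) (s : lamIdx lam) :
    (M * blockEmbed lam i) a s = if s.1 = i then M a (Fin.castLE (conj'_le lam _) s.2) else 0 := by
  rw [Matrix.mul_apply, Finset.sum_eq_single (Fin.castLE (conj'_le lam _) s.2)]
  · simp [blockEmbed]
  · intro b _ hb
    have : ¬ (s.2 : ℕ) = (b : ℕ) := fun h => hb (Fin.ext (by simp [h]))
    simp [blockEmbed, this]
  · simp

lemma blockEmbed_mul_apply {ι : Type*} (M : Matrix (lamIdx lam) ι ℂ)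
    (i : Fin (Finset.univ.sup lam)) (a : Fin k) (t : ι) :
    (blockEmbed lam i * M) a t =
      if h : (a : ℕ) < conj' lam (i : ℕ) then M ⟨i, ⟨a, h⟩⟩ t else 0 := by
  rw [Matrix.mul_apply]
  split_ifs with h
  · rw [Finset.sum_eq_single (⟨i, ⟨a, h⟩⟩ : lamIdx lam)]
    · simp [blockEmbed]
    · rintro ⟨j, b⟩ _ hb
      have : ¬ (j = i ∧ (b : ℕ) = (a : ℕ)) := by
        rintro ⟨rfl, hba⟩
        exact hb (by congr; exact Fin.ext hba)
      simp [blockEmbed, this]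
    · simp
  · refine Finset.sum_eq_zero ?_
    rintro ⟨j, b⟩ _
    have : ¬ (j = i ∧ (b : ℕ) = (a : ℕ)) := by
      rintro ⟨rfl, hba⟩
      exact h (hba ▸ b.2)
    simp [blockEmbed, this]

lemma GmapAdj_eq_sum (Y : Matrix (lamIdx lam) (lamIdx lam) ℂ) :
    GmapAdj lam Y = ∑ i, blockEmbed lam i * Y * (blockEmbed lam i)ᴴ := by
  ext a b
  rw [Matrix.sum_apply]
  refine Finset.sum_congr rfl fun i _ => ?_
  rw [Matrix.mul_assoc, blockEmbed_mul_apply]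
  have key (s : lamIdx lam) : (Y * (blockEmbed lam i)ᴴ) s b =
      if h : (b : ℕ) < conj' lam (i : ℕ) then Y s ⟨i, ⟨b, h⟩⟩ else 0 := by
    have := congrArg star (blockEmbed_mul_apply Yᴴ i b s)
    rw [← Matrix.conjTranspose_apply, Matrix.conjTranspose_mul, Matrix.conjTranspose_conjTranspose]
      at this
    rw [this]
    split_ifs <;> simp
  simp only [key]
  by_cases ha : (a : ℕ) < conj' lam (i : ℕ) <;> by_cases hb : (b : ℕ) < conj' lam (i : ℕ) <;>
    simp [ha, hb]

lemma blockEmbed_mul_Gmap {h : Matrix (Fin k) (Fin k) ℂ} (hh : UT h)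
    (i : Fin (Finset.univ.sup lam)) :
    blockEmbed lam i * Gmap lam h = h * blockEmbed lam i := by
  ext a ⟨j, b⟩
  rw [blockEmbed_mul_apply, mul_blockEmbed_apply]
  by_cases hij : j = i
  · subst hij
    by_cases ha : (a : ℕ) < conj' lam (j : ℕ)
    · simp [Gmap, ha]
    · have hba : Fin.castLE (conj'_le lam (j : ℕ)) b < a :=
        Fin.lt_def.2 (b.2.trans_le (not_lt.1 ha))
      simp [ha, hh _ _ hba]
  · have : ¬ i = j := fun h => hij h.symm
    simp [Gmap, hij, this]

lemma GmapAdj_conj {h : Matrix (Fin k) (Fin k) ℂ} (hh : UT h)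
    (X : Matrix (lamIdx lam) (lamIdx lam) ℂ) :
    GmapAdj lam (Gmap lam h * X * (Gmap lam h)ᴴ) = h * GmapAdj lam X * hᴴ := by
  simp only [GmapAdj_eq_sum, Matrix.mul_sum, Matrix.sum_mul]
  refine Finset.sum_congr rfl fun i _ => ?_
  calc blockEmbed lam i * (Gmap lam h * X * (Gmap lam h)ᴴ) * (blockEmbed lam i)ᴴ
      = (blockEmbed lam i * Gmap lam h) * X * (blockEmbed lam i * Gmap lam h)ᴴ := by
        simp only [Matrix.conjTranspose_mul, Matrix.mul_assoc]
    _ = _ := by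
        rw [blockEmbed_mul_Gmap hh]
        simp only [Matrix.conjTranspose_mul, Matrix.mul_assoc]

lemma Gmap_conjTranspose (X : Matrix (Fin k) (Fin k) ℂ) :
    Gmap lam Xᴴ = (Gmap lam X)ᴴ := by
  rw [Gmap_eq_blockDiagonal', Gmap_eq_blockDiagonal', Matrix.blockDiagonal'_conjTranspose]
  rfl

lemma leadingBlock_mul {c : ℕ} (hc : c ≤ k) (g : Matrix (Fin k) (Fin k) ℂ)
    {h : Matrix (Fin k) (Fin k) ℂ} (hh : UT h) :
    leadingBlock hc (g * h) = leadingBlock hc g * leadingBlock hc h := by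
  ext a b
  simp only [leadingBlock, Matrix.submatrix_apply, Matrix.mul_apply]
  symm
  refine (Finset.sum_map Finset.univ (Fin.castLEEmb hc)
    (fun l => g (Fin.castLE hc a) l * h l (Fin.castLE hc b))).symm.trans ?_
  refine Finset.sum_subset (Finset.subset_univ _) fun l _ hl => ?_
  have hbl : Fin.castLE hc b < l := by
    by_contra hlb
    rw [Fin.lt_def, Fin.val_castLE] at hlb
    exact hl (Finset.mem_map.2 ⟨⟨l, by omega⟩, Finset.mem_univ _, rfl⟩)
  rw [hh _ _ hbl, mul_zero]

lemma Gmap_mul (g : Matrix (Fin k) (Fin k) ℂ) {h : Matrix (Fin k) (Fin k) ℂ} (hh : UT h) :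
    Gmap lam (g * h) = Gmap lam g * Gmap lam h := by
  simp only [Gmap_eq_blockDiagonal', leadingBlock_mul _ g hh, Matrix.blockDiagonal'_mul]

lemma Gmap_one : Gmap lam (1 : Matrix (Fin k) (Fin k) ℂ) = 1 := by
  rw [Gmap_eq_blockDiagonal', ← Matrix.blockDiagonal'_one]
  congr 1
  ext i a b
  simp [leadingBlock, Matrix.one_apply]

lemma isUnit_Gmap {h : Matrix (Fin k) (Fin k) ℂ} (hh : UT h) (hu : IsUnit h.det) :
    IsUnit (Gmap lam h) := by
  have : Gmap lam h⁻¹ * Gmap lam h = 1 := by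
    rw [← Gmap_mul _ hh, Matrix.nonsing_inv_mul _ hu, Gmap_one]
  exact IsUnit.of_mul_eq_one_right _ this

lemma relDet_conjTranspose_mul_self (hl : Antitone lam) {h : Matrix (Fin k) (Fin k) ℂ}
    (hh : UT h) :
    ((relDet (fun j => (lam j : ℝ)) (hᴴ * h) : ℝ) : ℂ) =
      (Gmap lam h * (Gmap lam h)ᴴ).det := by
  rw [← det_Gmap_of_posSemidef hl (Matrix.posSemidef_conjTranspose_mul_self h), Gmap_mul _ hh,
    Gmap_conjTranspose, Matrix.det_mul, Matrix.det_mul, mul_comm]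

lemma GmapAdj_one (hl : Antitone lam) :
    GmapAdj lam 1 = Matrix.diagonal fun j => (lam j : ℂ) := by
  ext a b
  have hterm (i : Fin (Finset.univ.sup lam)) :
      (if h : (a : ℕ) < conj' lam (i : ℕ) ∧ (b : ℕ) < conj' lam (i : ℕ) then
        (1 : Matrix (lamIdx lam) (lamIdx lam) ℂ) ⟨i, ⟨(a : ℕ), h.1⟩⟩ ⟨i, ⟨(b : ℕ), h.2⟩⟩
        else 0) = if a = b ∧ (i : ℕ) < lam a then 1 else 0 := by
    by_cases hab : a = b
    · subst hab
      simp [lt_conj'_iff hl]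
    · have : ¬ (a : ℕ) = (b : ℕ) := fun h => hab (Fin.ext h)
      simp [hab, this]
  simp only [GmapAdj, hterm]
  by_cases hab : a = b
  · subst hab
    simp [Fin.card_filter_val_lt, le_sup_univ]
  · simp [hab]

lemma trace_GmapAdj (X : Matrix (lamIdx lam) (lamIdx lam) ℂ) :
    (GmapAdj lam X).trace = X.trace := by
  have hsum : ∑ i, (blockEmbed lam i)ᴴ * blockEmbed lam i = 1 := by
    ext ⟨i, a⟩ ⟨j, b⟩
    simp only [Matrix.sum_apply, mul_blockEmbed_apply, Matrix.conjTranspose_apply]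
    simp only [blockEmbed, Matrix.of_apply, Finset.sum_ite_eq, Finset.mem_univ, if_true]
    by_cases hij : i = j
    · subst hij
      by_cases hab : a = b
      · subst hab
        simp
      · have : ¬ (a : ℕ) = (b : ℕ) := fun h => hab (Fin.ext h)
        simp [hab, this]
    · simp [hij]
  calc (GmapAdj lam X).trace = ∑ i, ((blockEmbed lam i)ᴴ * blockEmbed lam i * X).trace := by
        rw [GmapAdj_eq_sum, Matrix.trace_sum]
        refine Finset.sum_congr rfl fun i _ => ?_
        rw [Matrix.trace_mul_comm, ← Matrix.mul_assoc]
    _ = X.trace := by rw [← Matrix.trace_sum, ← Matrix.sum_mul, hsum, Matrix.one_mul]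

lemma posSemidef_GmapAdj {X : Matrix (lamIdx lam) (lamIdx lam) ℂ} (hX : X.PosSemidef) :
    (GmapAdj lam X).PosSemidef := by
  rw [GmapAdj_eq_sum]
  exact Matrix.posSemidef_sum _ fun i _ => hX.mul_mul_conjTranspose_same _

lemma posDef_GmapAdj (hl : Antitone lam) (hl0 : ∀ j, 0 < lam j)
    {X : Matrix (lamIdx lam) (lamIdx lam) ℂ} (hX : X.PosDef) :
    (GmapAdj lam X).PosDef := by
  refine Matrix.PosDef.of_dotProduct_mulVec_pos (posSemidef_GmapAdj hX.posSemidef).isHermitian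
    fun x hx => ?_
  obtain ⟨a, ha⟩ := Function.ne_iff.1 hx
  let i₀ : Fin (Finset.univ.sup lam) := ⟨0, (hl0 a).trans_le (le_sup_univ a)⟩
  rw [GmapAdj_eq_sum, Matrix.sum_mulVec, dotProduct_sum]
  have hterm (i : Fin (Finset.univ.sup lam)) :
      star x ⬝ᵥ ((blockEmbed lam i * X * (blockEmbed lam i)ᴴ) *ᵥ x) =
        star ((blockEmbed lam i)ᴴ *ᵥ x) ⬝ᵥ (X *ᵥ ((blockEmbed lam i)ᴴ *ᵥ x)) := by
    rw [Matrix.star_mulVec, Matrix.conjTranspose_conjTranspose, ← Matrix.dotProduct_mulVec,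
      Matrix.mulVec_mulVec, Matrix.mulVec_mulVec]
  simp only [hterm]
  refine Finset.sum_pos' (fun i _ => hX.posSemidef.dotProduct_mulVec_nonneg _)
    ⟨i₀, Finset.mem_univ _, hX.dotProduct_mulVec_pos fun h0 => ha ?_⟩
  have hac : (a : ℕ) < conj' lam (i₀ : ℕ) := (lt_conj'_iff hl a _).2 (hl0 a)
  have := congrFun h0 ⟨i₀, ⟨a, hac⟩⟩
  rw [Matrix.mulVec, dotProduct, Finset.sum_eq_single a] at this
  · simpa [blockEmbed] using this
  · intro b _ hb
    have : ¬ (a : ℕ) = (b : ℕ) := fun h => hb (Fin.ext h.symm)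
    simp [blockEmbed, this]
  · simp

lemma card_lamIdx (hl : Antitone lam) : Fintype.card (lamIdx lam) = ∑ j, lam j := by
  have h := trace_GmapAdj (1 : Matrix (lamIdx lam) (lamIdx lam) ℂ)
  rw [GmapAdj_one hl, Matrix.trace_diagonal, Matrix.trace_one] at h
  exact_mod_cast h.symm

end Gadget

lemma det_re_le_exp_trace {ι : Type*} [Fintype ι] [DecidableEq ι] {X : Matrix ι ι ℂ}
    (hX : X.PosSemidef) : X.det.re ≤ Real.exp (X.trace.re - Fintype.card ι) := by
  rw [hX.isHermitian.det_eq_prod_eigenvalues, hX.isHermitian.trace_eq_sum_eigenvalues]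
  have h1 : (∏ i, (hX.isHermitian.eigenvalues i : ℂ)).re = ∏ i, hX.isHermitian.eigenvalues i := by
    rw [← Complex.ofReal_prod, Complex.ofReal_re]
  have h2 : (∑ i, (hX.isHermitian.eigenvalues i : ℂ)).re - Fintype.card ι =
      ∑ i, (hX.isHermitian.eigenvalues i - 1) := by
    rw [← Complex.ofReal_sum, Complex.ofReal_re]
    simp [Finset.sum_sub_distrib]
  refine h1.trans_le ?_
  refine le_of_le_of_eq ?_ (congrArg Real.exp h2.symm)
  rw [Real.exp_sum]
  refine Finset.prod_le_prod (fun i _ => hX.eigenvalues_nonneg i) fun i _ => ?_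
  linarith [Real.add_one_le_exp (hX.isHermitian.eigenvalues i - 1)]

/-- Every positive definite `Y` is `u D uᴴ` with `u` upper triangular and `D` diagonal. -/
lemma exists_upper_ldl {k : ℕ} {Y : Matrix (Fin k) (Fin k) ℂ} (hY : Y.PosDef) :
    ∃ (u : Matrix (Fin k) (Fin k) ℂ) (d : Fin k → ℂ), UT u ∧ IsUnit u.det ∧
      u * Matrix.diagonal d * uᴴ = Y := by
  let e : (Fin k)ᵒᵈ ≃ Fin k := OrderDual.ofDual
  let S : Matrix (Fin k)ᵒᵈ (Fin k)ᵒᵈ ℂ := Y.submatrix e e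
  have hS : S.PosDef := hY.submatrix e.injective
  have htri : (LDL.lowerInv hS).BlockTriangular e := fun i j hij => LDL.lowerInv_triangular hS hij
  have hinv : (LDL.lower hS).BlockTriangular e :=
    Matrix.blockTriangular_inv_of_blockTriangular htri
  refine ⟨(LDL.lower hS).submatrix e.symm e.symm, LDL.diagEntries hS ∘ e.symm,
    fun i j hij => hinv (by simpa using hij), ?_, ?_⟩
  · rw [Matrix.det_submatrix_equiv_self, LDL.lower]
    exact Matrix.isUnit_nonsing_inv_det _
      ((Matrix.isUnit_iff_isUnit_det _).1 (isUnit_of_invertible (LDL.lowerInv hS)))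
  · have h := congrArg (fun M => M.submatrix e.symm e.symm) (LDL.lower_conj_diag hS)
    have hSY : S.submatrix e.symm e.symm = Y := by
      ext i j
      simp [S]
    simp only [hSY] at h
    rw [← h, LDL.diag]
    simp only [← Matrix.submatrix_mul_equiv _ _ _ e.symm _, Matrix.conjTranspose_submatrix,
      Matrix.submatrix_diagonal_equiv]

/-- Every positive definite `Y` is `h P hᴴ` with `h` upper triangular, for a given positive
diagonal `P`. -/
lemma exists_upper_conj_diagonal {k : ℕ} {Y : Matrix (Fin k) (Fin k) ℂ} (hY : Y.PosDef)
    {p : Fin k → ℝ} (hp : ∀ j, 0 < p j) :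
    ∃ h : Matrix (Fin k) (Fin k) ℂ, IsUnit h.det ∧ UT h ∧
      h * Matrix.diagonal (fun j => (p j : ℂ)) * hᴴ = Y := by
  obtain ⟨u, d, hu, hdet, hud⟩ := exists_upper_ldl hY
  have hD : (Matrix.diagonal d).PosDef := by
    have huu : IsUnit u := (Matrix.isUnit_iff_isUnit_det _).2 hdet
    rw [← Matrix.IsUnit.posDef_star_right_conjugate_iff huu, Matrix.star_eq_conjTranspose, hud]
    exact hY
  have hd (j : Fin k) : 0 < (d j).re ∧ (d j : ℂ) = ((d j).re : ℂ) := by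
    have := Matrix.posDef_diagonal_iff.1 hD j
    exact ⟨(Complex.lt_def.1 this).1, Complex.eq_re_of_ofReal_le (r := 0) (by simpa using this.le)⟩
  set s : Fin k → ℝ := fun j => Real.sqrt ((d j).re / p j) with hs
  have hs0 (j : Fin k) : s j ≠ 0 := (Real.sqrt_pos.2 (div_pos (hd j).1 (hp j))).ne'
  refine ⟨u * Matrix.diagonal fun j => (s j : ℂ), ?_, ?_, ?_⟩
  · rw [Matrix.det_mul, Matrix.det_diagonal]
    refine hdet.mul (isUnit_iff_ne_zero.2 (Finset.prod_ne_zero_iff.2 fun j _ => ?_))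
    exact_mod_cast hs0 j
  · intro i j hij
    rw [Matrix.mul_diagonal, hu i j hij, zero_mul]
  · rw [← hud, Matrix.conjTranspose_mul, Matrix.diagonal_conjTranspose]
    have hmid : (Matrix.diagonal fun j => (s j : ℂ)) * (Matrix.diagonal fun j => (p j : ℂ)) *
        Matrix.diagonal (star fun j => (s j : ℂ)) = Matrix.diagonal d := by
      rw [Matrix.diagonal_mul_diagonal, Matrix.diagonal_mul_diagonal]
      congr 1
      ext1 j
      rw [(hd j).2]
      simp only [Pi.star_apply, Complex.star_def, Complex.conj_ofReal]
      have : s j * p j * s j = (d j).re := by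
        rw [mul_right_comm, hs, Real.mul_self_sqrt (div_pos (hd j).1 (hp j)).le,
          div_mul_cancel₀ _ (hp j).ne']
      exact_mod_cast this
    rw [← hmid]
    simp only [Matrix.mul_assoc]

lemma posSemidef_cpMap {ι κ : Type*} [Fintype ι] [Fintype κ] {r : ℕ} (A : Fin r → Matrix κ ι ℂ)
    {X : Matrix ι ι ℂ} (hX : X.PosSemidef) : (cpMap A X).PosSemidef :=
  Matrix.posSemidef_sum _ fun i _ => hX.mul_mul_conjTranspose_same (A i)

lemma trun_det_re {n m r : ℕ} (A : Fin r → Matrix (Fin m) (Fin n) ℂ)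
    {p : Fin n → ℕ} {q : Fin m → ℕ} (hq : Antitone q)
    {X : Matrix (lamIdx p) (lamIdx p) ℂ} (hX : X.PosSemidef) :
    (trun A p q X).det.re = relDet (fun i => (q i : ℝ)) (cpMap A (GmapAdj p X)) := by
  rw [trun, det_Gmap_of_posSemidef hq (posSemidef_cpMap A (posSemidef_GmapAdj hX)),
    Complex.ofReal_re]

/-- A positive definite `X` with `G_p*(X) = h P hᴴ` has determinant at most `det(P, hᴴ h)`. -/
lemma det_re_le_relDet {n : ℕ} {p : Fin n → ℕ} (hp : Antitone p)
    {X : Matrix (lamIdx p) (lamIdx p) ℂ} (hX : X.PosDef) {h : Matrix (Fin n) (Fin n) ℂ}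
    (hdet : IsUnit h.det) (hh : UT h)
    (hhX : h * Matrix.diagonal (fun j => (p j : ℂ)) * hᴴ = GmapAdj p X) :
    X.det.re ≤ relDet (fun j => (p j : ℝ)) (hᴴ * h) := by
  have hH : IsUnit (Gmap p h) := isUnit_Gmap hh hdet
  have hHdet : IsUnit (Gmap p h).det := (Matrix.isUnit_iff_isUnit_det _).1 hH
  set X' := (Gmap p h)⁻¹ * X * ((Gmap p h)⁻¹)ᴴ with hX'
  have hXX' : Gmap p h * X' * (Gmap p h)ᴴ = X := by
    rw [hX', Matrix.conjTranspose_nonsing_inv]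
    have hHc : IsUnit ((Gmap p h)ᴴ).det := by
      rw [Matrix.det_conjTranspose]
      exact hHdet.star
    rw [Matrix.mul_assoc (Gmap p h)⁻¹, Matrix.mul_nonsing_inv_cancel_left _ _ hHdet,
      Matrix.nonsing_inv_mul_cancel_right _ _ hHc]
  have hX'psd : X'.PosSemidef := hX.posSemidef.mul_mul_conjTranspose_same _
  have hadj : GmapAdj p X' = Matrix.diagonal fun j => (p j : ℂ) := by
    have hhu : IsUnit h := (Matrix.isUnit_iff_isUnit_det _).2 hdet
    have hhc : IsUnit hᴴ := hhu.star
    rw [← hXX', GmapAdj_conj hh] at hhX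
    exact (hhu.mul_left_cancel (hhc.mul_right_cancel hhX)).symm
  have htr : X'.trace.re - Fintype.card (lamIdx p) = 0 := by
    rw [← trace_GmapAdj, hadj, Matrix.trace_diagonal, card_lamIdx hp, ← Nat.cast_sum,
      Complex.natCast_re, sub_self]
  have hle : X'.det.re ≤ 1 := by
    simpa only [htr, Real.exp_zero] using det_re_le_exp_trace hX'psd
  have hrel := relDet_conjTranspose_mul_self hp hh
  have hXdet : X.det.re = relDet (fun j => (p j : ℝ)) (hᴴ * h) * X'.det.re := by
    rw [← Complex.re_ofReal_mul, hrel, ← hXX']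
    simp only [Matrix.det_mul]
    congr 1
    ring
  rw [hXdet]
  exact mul_le_of_le_one_right
    (relDet_nonneg (Matrix.posSemidef_conjTranspose_mul_self h)) hle

/-- Theorem: for integral marginals, the Gurvits capacity of the reduced operator equals the
capacity with specified marginals: `inf_{X ≻ 0} det(trun_{P,Q}T (X)) / det X = cap(T, P, Q)`. -/
theorem stmt3 {n m r N : ℕ} (A : Fin r → Matrix (Fin m) (Fin n) ℂ)
    (p : Fin n → ℕ) (q : Fin m → ℕ)
    (hp : Antitone p) (hp0 : ∀ j, 0 < p j) (hq : Antitone q) (hq0 : ∀ i, 0 < q i)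
    (hpN : ∑ j, p j = N) (hqN : ∑ i, q i = N) :
    sInf { x : ℝ | ∃ X : Matrix (lamIdx p) (lamIdx p) ℂ, X.PosDef ∧
        x = (trun A p q X).det.re / X.det.re }
      = cap A (fun j => (p j : ℝ)) (fun i => (q i : ℝ)) := by
  have hpos {h : Matrix (Fin n) (Fin n) ℂ} (hh : UT h) (hdet : IsUnit h.det) :
      (Gmap p h * (Gmap p h)ᴴ).PosDef :=
    Matrix.PosDef.mul_conjTranspose_self _
      (Matrix.vecMul_injective_of_isUnit (isUnit_Gmap hh hdet))
  have hUT1 : UT (1 : Matrix (Fin n) (Fin n) ℂ) := fun i j hij => Matrix.one_apply_ne hij.ne'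
  refine le_antisymm ?_ ?_
  · refine le_csInf ⟨_, 1, by simp, hUT1, rfl⟩ ?_
    rintro x ⟨h, hdet, hh, rfl⟩
    refine csInf_le ⟨0, ?_⟩ ⟨Gmap p h * (Gmap p h)ᴴ, hpos hh hdet, ?_⟩
    · rintro x ⟨X, hX, rfl⟩
      rw [trun_det_re A hq hX.posSemidef]
      exact div_nonneg (relDet_nonneg (posSemidef_cpMap A (posSemidef_GmapAdj hX.posSemidef)))
        (Complex.le_def.1 hX.posSemidef.det_nonneg).1
    · have hadj : GmapAdj p (Gmap p h * (Gmap p h)ᴴ) =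
          h * Matrix.diagonal (fun j => (p j : ℂ)) * hᴴ := by
        rw [← GmapAdj_one hp, ← GmapAdj_conj hh, Matrix.mul_one]
      rw [trun_det_re A hq (hpos hh hdet).posSemidef, hadj, ← relDet_conjTranspose_mul_self hp hh,
        Complex.ofReal_re]
      simp only [Complex.ofReal_natCast]
  · refine le_csInf ⟨_, 1, Matrix.PosDef.one, rfl⟩ ?_
    rintro x ⟨X, hX, rfl⟩
    obtain ⟨h, hdet, hh, hhX⟩ := exists_upper_conj_diagonal (posDef_GmapAdj hp hp0 hX)
      (p := fun j => (p j : ℝ)) (fun j => Nat.cast_pos.2 (hp0 j))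
    have hpsd := posSemidef_cpMap A (posSemidef_GmapAdj hX.posSemidef)
    have hXle : X.det.re ≤ relDet (fun j => (p j : ℝ)) (hᴴ * h) :=
      det_re_le_relDet hp hX hdet hh (by simpa using hhX)
    have hXpos : 0 < X.det.re := (Complex.lt_def.1 hX.det_pos).1
    refine csInf_le_of_le ⟨0, ?_⟩ ⟨h, hdet, hh, rfl⟩ ?_
    · rintro x ⟨g, -, -, rfl⟩
      refine div_nonneg (relDet_nonneg (posSemidef_cpMap A ?_))
        (relDet_nonneg (Matrix.posSemidef_conjTranspose_mul_self g))
      refine Matrix.PosSemidef.mul_mul_conjTranspose_same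
        (Matrix.PosSemidef.diagonal fun j => ?_) g
      simp
    · rw [trun_det_re A hq hX.posSemidef, hhX]
      exact div_le_div_of_nonneg_left (relDet_nonneg hpsd) hXpos hXle
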